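/- Let d ≥ 2. The order of the quotient group C(d)/Cc(d) equals d² · Σ_{n=0}^{d−1} ν(n,d)·ν(n+1,d), where ν(n,d) is the number of ordered pairs (x,y) ∈ (ℤ/dℤ)² with xy = n in ℤ/dℤ. -/

import Mathlib

noncomputable section
open Matrix Complex

def dbar (d : ℕ) : ℕ := if d % 2 = 1 then d else 2 * d

lemma dvd_dbar (d : ℕ) : d ∣ dbar d := by
  unfold dbar; split_ifs
  · exact dvd_rfl
  · exact Dvd.intro_left 2 rfl

def omega (d : ℕ) : ℂ := Complex.exp (2 * Real.pi * Complex.I / d)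
def tau (d : ℕ) : ℂ := -Complex.exp (Real.pi * Complex.I / d)
def Tmat (d : ℕ) : Matrix (Fin d) (Fin d) ℂ :=
  Matrix.diagonal fun r => omega d ^ (r : ℕ)
def Smat (d : ℕ) : Matrix (Fin d) (Fin d) ℂ :=
  Matrix.of fun r s => if (r : ℕ) = ((s : ℕ) + 1) % d then 1 else 0
def Dmat (d : ℕ) (p : ℤ × ℤ) : Matrix (Fin d) (Fin d) ℂ :=
  tau d ^ (p.1 * p.2) • (Smat d ^ p.1 * Tmat d ^ p.2)
def symp (p q : ℤ × ℤ) : ℤ := p.2 * q.1 - p.1 * q.2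
def Fapp (F : Matrix (Fin 2) (Fin 2) ℤ) (p : ℤ × ℤ) : ℤ × ℤ :=
  (F 0 0 * p.1 + F 0 1 * p.2, F 1 0 * p.1 + F 1 1 * p.2)
def Wset (d : ℕ) : Set (Matrix (Fin d) (Fin d) ℂ) :=
  {M | ∃ ξ : ℝ, ∃ p : ℤ × ℤ, M = Complex.exp (ξ * Complex.I) • Dmat d p}

/-- The Clifford group `C(d)`: the normalizer of `W(d)` inside the unitary group. -/
def Cliff (d : ℕ) : Subgroup (Matrix.unitaryGroup (Fin d) ℂ) where
  carrier := {U | (fun M => (U : Matrix (Fin d) (Fin d) ℂ) * M * (U : Matrix (Fin d) (Fin d) ℂ)ᴴ) '' Wset d = Wset d}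
  one_mem' := by
    simp only [Set.mem_setOf_eq, OneMemClass.coe_one, Matrix.one_mul, conjTranspose_one,
      Matrix.mul_one]
    exact Set.image_id _
  mul_mem' := by
    intro U V hU hV
    simp only [Set.mem_setOf_eq] at *
    have h : (fun M => ((U * V : Matrix.unitaryGroup (Fin d) ℂ) : Matrix (Fin d) (Fin d) ℂ) * M *
          ((U * V : Matrix.unitaryGroup (Fin d) ℂ) : Matrix (Fin d) (Fin d) ℂ)ᴴ) =
        (fun M => (U : Matrix (Fin d) (Fin d) ℂ) * M * (U : Matrix (Fin d) (Fin d) ℂ)ᴴ) ∘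
        (fun M => (V : Matrix (Fin d) (Fin d) ℂ) * M * (V : Matrix (Fin d) (Fin d) ℂ)ᴴ) := by
      funext M
      simp [Function.comp, Matrix.conjTranspose_mul, Matrix.mul_assoc]
    rw [h, Set.image_comp, hV, hU]
  inv_mem' := by
    intro U hU
    simp only [Set.mem_setOf_eq] at *
    have hsm : (U : Matrix (Fin d) (Fin d) ℂ)ᴴ * (U : Matrix (Fin d) (Fin d) ℂ) = 1 :=
      Matrix.UnitaryGroup.star_mul_self U
    have key : ((fun M => ((U⁻¹ : Matrix.unitaryGroup (Fin d) ℂ) : Matrix (Fin d) (Fin d) ℂ) * M *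
          ((U⁻¹ : Matrix.unitaryGroup (Fin d) ℂ) : Matrix (Fin d) (Fin d) ℂ)ᴴ) ∘
        (fun M => (U : Matrix (Fin d) (Fin d) ℂ) * M * (U : Matrix (Fin d) (Fin d) ℂ)ᴴ)) = id := by
      funext M
      show (U : Matrix (Fin d) (Fin d) ℂ)ᴴ *
          ((U : Matrix (Fin d) (Fin d) ℂ) * M * (U : Matrix (Fin d) (Fin d) ℂ)ᴴ) *
          ((U : Matrix (Fin d) (Fin d) ℂ)ᴴ)ᴴ = M
      rw [Matrix.conjTranspose_conjTranspose]
      calc (U : Matrix (Fin d) (Fin d) ℂ)ᴴ *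
            ((U : Matrix (Fin d) (Fin d) ℂ) * M * (U : Matrix (Fin d) (Fin d) ℂ)ᴴ) *
            (U : Matrix (Fin d) (Fin d) ℂ)
          = ((U : Matrix (Fin d) (Fin d) ℂ)ᴴ * (U : Matrix (Fin d) (Fin d) ℂ)) * M *
              ((U : Matrix (Fin d) (Fin d) ℂ)ᴴ * (U : Matrix (Fin d) (Fin d) ℂ)) := by
            simp only [Matrix.mul_assoc]
        _ = M := by rw [hsm]; simp
    conv_lhs => rw [← hU]
    rw [← Set.image_comp, key, Set.image_id]

/-- The subgroup `Cc(d)` of scalar multiples of the identity inside `C(d)`. -/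
def CcSub (d : ℕ) : Subgroup (Cliff d) where
  carrier := {U | ∃ c : ℂ, ((U : Matrix.unitaryGroup (Fin d) ℂ) : Matrix (Fin d) (Fin d) ℂ) = c • (1 : Matrix (Fin d) (Fin d) ℂ)}
  one_mem' := ⟨1, by simp⟩
  mul_mem' := by
    rintro a b ⟨c, hc⟩ ⟨c', hc'⟩
    exact ⟨c * c', by push_cast [hc, hc', smul_smul]; simp [hc, hc', smul_smul, mul_comm]⟩
  inv_mem' := by
    rintro a ⟨c, hc⟩
    refine ⟨(starRingEnd ℂ) c, ?_⟩
    calc (((a⁻¹ : Cliff d) : Matrix.unitaryGroup (Fin d) ℂ) : Matrix (Fin d) (Fin d) ℂ)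
        = (((a : Matrix.unitaryGroup (Fin d) ℂ) : Matrix (Fin d) (Fin d) ℂ))ᴴ := rfl
      _ = (c • (1 : Matrix (Fin d) (Fin d) ℂ))ᴴ := by rw [hc]
      _ = (starRingEnd ℂ) c • 1 := by simp

instance CcNormal (d : ℕ) : (CcSub d).Normal := by
  constructor
  rintro n ⟨c, hc⟩ g
  refine ⟨c, ?_⟩
  have hms : ((g : Matrix.unitaryGroup (Fin d) ℂ) : Matrix (Fin d) (Fin d) ℂ) *
      ((g : Matrix.unitaryGroup (Fin d) ℂ) : Matrix (Fin d) (Fin d) ℂ)ᴴ = 1 := by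
    have := Matrix.mem_unitaryGroup_iff.mp (g : Matrix.unitaryGroup (Fin d) ℂ).2
    simpa [Matrix.star_eq_conjTranspose] using this
  calc (((g * n * g⁻¹ : Cliff d) : Matrix.unitaryGroup (Fin d) ℂ) : Matrix (Fin d) (Fin d) ℂ)
      = ((g : Matrix.unitaryGroup (Fin d) ℂ) : Matrix (Fin d) (Fin d) ℂ) *
          ((n : Matrix.unitaryGroup (Fin d) ℂ) : Matrix (Fin d) (Fin d) ℂ) *
          ((g : Matrix.unitaryGroup (Fin d) ℂ) : Matrix (Fin d) (Fin d) ℂ)ᴴ := rfl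
    _ = c • (1 : Matrix (Fin d) (Fin d) ℂ) := by
        rw [hc]
        simp [Matrix.mul_smul, Matrix.smul_mul, hms]

/-- `ν(n,d)`: the number of ordered pairs `(x,y) ∈ (ℤ/dℤ)²` with `xy = n`. -/
def nu (d n : ℕ) : ℕ := Nat.card {xy : ZMod d × ZMod d // xy.1 * xy.2 = (n : ZMod d)}

lemma star_mulVec_dotProduct_mulVec {n : Type*} [Fintype n] [DecidableEq n]
    {V : Matrix n n ℂ} (hV : V ∈ Matrix.unitaryGroup n ℂ) (x y : n → ℂ) :
    star (V *ᵥ x) ⬝ᵥ (V *ᵥ y) = star x ⬝ᵥ y := by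
  rw [Matrix.star_mulVec, Matrix.dotProduct_mulVec, Matrix.vecMul_vecMul,
    ← Matrix.star_eq_conjTranspose, Matrix.mem_unitaryGroup_iff'.1 hV, Matrix.vecMul_one]

lemma norm_tau (d : ℕ) : ‖tau d‖ = 1 := by
  have h : (Real.pi * Complex.I / d : ℂ) = ((Real.pi / d : ℝ) : ℂ) * Complex.I := by
    push_cast; ring
  rw [tau, norm_neg, h, Complex.norm_exp_ofReal_mul_I]

section
variable {d : ℕ}

/-- The Weyl operator `S ^ p₁ T ^ p₂`, indexed by `p ∈ (ℤ/dℤ)²`. -/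
def weyl (p : ZMod d × ZMod d) : Matrix (Fin d) (Fin d) ℂ :=
  Smat d ^ p.1.val * Tmat d ^ p.2.val

lemma weyl_zero : weyl (0 : ZMod d × ZMod d) = 1 := by
  simp [weyl]

/-- `M` agrees with the Weyl operator at `p` up to a phase. -/
def IsPhaseWeyl (p : ZMod d × ZMod d) (M : Matrix (Fin d) (Fin d) ℂ) : Prop :=
  ∃ c : ℂ, ‖c‖ = 1 ∧ M = c • weyl p

lemma isPhaseWeyl_weyl (p : ZMod d × ZMod d) : IsPhaseWeyl p (weyl p) :=
  ⟨1, norm_one, (one_smul _ _).symm⟩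

lemma IsPhaseWeyl.smul {p : ZMod d × ZMod d} {M : Matrix (Fin d) (Fin d) ℂ}
    (hM : IsPhaseWeyl p M) {c : ℂ} (hc : ‖c‖ = 1) : IsPhaseWeyl p (c • M) := by
  obtain ⟨c', hc', rfl⟩ := hM
  exact ⟨c * c', by rw [norm_mul, hc, hc', one_mul], smul_smul _ _ _⟩

variable [NeZero d]

lemma omega_eq_stdAddChar : omega d = ZMod.stdAddChar (1 : ZMod d) := by
  have h := ZMod.stdAddChar_coe (N := d) 1
  simpa [omega] using h.symm

lemma omega_pow (n : ℕ) : omega d ^ n = ZMod.stdAddChar (n : ZMod d) := by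
  rw [omega_eq_stdAddChar, ← AddChar.map_nsmul_eq_pow, nsmul_one]

lemma norm_omega : ‖omega d‖ = 1 := by
  rw [omega_eq_stdAddChar, ZMod.stdAddChar_apply, Circle.norm_coe]

lemma Smat_pow_apply (n : ℕ) (r s : Fin d) :
    (Smat d ^ n) r s = if (r : ℕ) = ((s : ℕ) + n) % d then 1 else 0 := by
  induction n generalizing r with
  | zero => simp [Matrix.one_apply, Nat.mod_eq_of_lt s.2, Fin.ext_iff]
  | succ n ih =>
    have hd : 0 < d := Nat.pos_of_ne_zero (NeZero.ne d)
    rw [pow_succ', Matrix.mul_apply, Finset.sum_eq_single ⟨((s : ℕ) + n) % d, Nat.mod_lt _ hd⟩]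
    · rw [ih]
      simp [Smat, add_assoc]
    · intro b _ hb
      rw [ih, if_neg (fun h => hb (Fin.ext h)), mul_zero]
    · simp

lemma Smat_pow_self : Smat d ^ d = 1 := by
  ext r s
  simp [Smat_pow_apply, Matrix.one_apply, Nat.mod_eq_of_lt s.2, Fin.ext_iff]

lemma Tmat_pow_self : Tmat d ^ d = 1 := by
  rw [Tmat, Matrix.diagonal_pow, ← Matrix.diagonal_one]
  congr 1
  ext r
  simp only [Pi.pow_apply]
  rw [← pow_mul, omega_pow]
  simp

lemma Tmat_mul_Smat : Tmat d * Smat d = omega d • (Smat d * Tmat d) := by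
  ext r s
  rw [Tmat, Matrix.diagonal_mul, Matrix.smul_apply, Matrix.mul_diagonal]
  simp only [Smat, Matrix.of_apply, smul_eq_mul]
  split_ifs with h
  · rw [h, omega_pow, omega_pow, omega_eq_stdAddChar, mul_one, one_mul, ← AddChar.map_add_eq_mul]
    simp [add_comm]
  · simp

lemma Smat_mem_unitaryGroup : Smat d ∈ Matrix.unitaryGroup (Fin d) ℂ := by
  rw [Matrix.mem_unitaryGroup_iff', Matrix.star_eq_conjTranspose]
  have hd : 0 < d := Nat.pos_of_ne_zero (NeZero.ne d)
  ext r s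
  rw [Matrix.mul_apply, Finset.sum_eq_single ⟨((s : ℕ) + 1) % d, Nat.mod_lt _ hd⟩]
  · simp only [Smat, Matrix.conjTranspose_apply, Matrix.of_apply, Matrix.one_apply, if_true, mul_one]
    have : ((s : ℕ) + 1) % d = ((r : ℕ) + 1) % d ↔ r = s := by
      constructor
      · intro h
        have h' : (s : ℕ) ≡ r [MOD d] := Nat.ModEq.add_right_cancel' 1 h
        exact Fin.ext (Nat.ModEq.eq_of_lt_of_lt h'.symm r.2 s.2)
      · rintro rfl; rfl
    simp only [this]
    split_ifs <;> simp
  · intro b _ hb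
    have : (b : ℕ) ≠ ((s : ℕ) + 1) % d := fun h => hb (Fin.ext h)
    simp [Smat, this]
  · simp

lemma Tmat_mem_unitaryGroup : Tmat d ∈ Matrix.unitaryGroup (Fin d) ℂ := by
  rw [Matrix.mem_unitaryGroup_iff', Matrix.star_eq_conjTranspose, Tmat,
    Matrix.diagonal_conjTranspose, Matrix.diagonal_mul_diagonal, ← Matrix.diagonal_one]
  congr 1
  ext r
  have h : ‖omega d ^ (r : ℕ)‖ = 1 := by rw [norm_pow, norm_omega, one_pow]
  simp only [Pi.star_apply, RCLike.star_def]
  rw [Complex.conj_mul', h]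
  simp

/-- A matrix commuting with both `S` and `T` is scalar. -/
lemma eq_smul_one_of_commute {M : Matrix (Fin d) (Fin d) ℂ} (hS : M * Smat d = Smat d * M)
    (hT : M * Tmat d = Tmat d * M) : ∃ c : ℂ, M = c • 1 := by
  have hd : 0 < d := Nat.pos_of_ne_zero (NeZero.ne d)
  have hoff : ∀ r s : Fin d, r ≠ s → M r s = 0 := by
    intro r s hrs
    have h := congrFun (congrFun hT r) s
    rw [Tmat, Matrix.mul_diagonal, Matrix.diagonal_mul, omega_pow, omega_pow, mul_comm] at h
    by_contra h0
    have h1 := ZMod.injective_stdAddChar (mul_right_cancel₀ h0 h)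
    rw [ZMod.natCast_eq_natCast_iff] at h1
    exact hrs (Fin.ext (Nat.ModEq.eq_of_lt_of_lt h1.symm r.2 s.2))
  have hpow : ∀ n, M * Smat d ^ n = Smat d ^ n * M := fun n =>
    ((show Commute M (Smat d) from hS).pow_right n)
  refine ⟨M 0 0, ?_⟩
  ext r s
  by_cases hrs : r = s
  · subst hrs
    have h := congrFun (congrFun (hpow r) r) 0
    rw [Matrix.mul_apply, Matrix.mul_apply, Finset.sum_eq_single r, Finset.sum_eq_single 0] at h
    · simpa [Smat_pow_apply, Nat.mod_eq_of_lt r.2] using h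
    · intro b _ hb
      rw [hoff b 0 hb, mul_zero]
    · simp
    · intro b _ hb
      rw [hoff r b hb.symm, zero_mul]
    · simp
  · simp [hoff r s hrs, hrs]

section IntertwiningPair

variable {A B : Matrix (Fin d) (Fin d) ℂ}

lemma pow_mul_pow_of_mul_eq_omega_smul (h : B * A = omega d • (A * B)) (n m : ℕ) :
    B ^ n * A ^ m = ZMod.stdAddChar ((n : ZMod d) * (m : ZMod d)) • (A ^ m * B ^ n) := by
  have h1 : ∀ n : ℕ, B ^ n * A = ZMod.stdAddChar (n : ZMod d) • (A * B ^ n) := by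
    intro n
    induction n with
    | zero => simp
    | succ n ih =>
      rw [pow_succ', Matrix.mul_assoc, ih, Matrix.mul_smul, ← Matrix.mul_assoc, h,
        omega_eq_stdAddChar, Matrix.smul_mul, smul_smul, ← AddChar.map_add_eq_mul,
        Matrix.mul_assoc, Nat.cast_succ]
  induction m with
  | zero => simp
  | succ m ih =>
    rw [pow_succ, ← Matrix.mul_assoc, ih, Matrix.smul_mul, Matrix.mul_assoc, h1, Matrix.mul_smul,
      smul_smul, ← AddChar.map_add_eq_mul, ← Matrix.mul_assoc, Nat.cast_succ, mul_add, mul_one]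

lemma trace_pow_eq_zero (hA : A ^ d = 1) (h : B * A = omega d • (A * B)) {n : ℕ}
    (hn : (n : ZMod d) ≠ 0) : (B ^ n).trace = 0 := by
  have hinv : A ^ (d - 1) * A = 1 := by
    rw [← pow_succ, Nat.sub_add_cancel (Nat.pos_of_ne_zero (NeZero.ne d)), hA]
  have h1 : (B ^ n).trace = ZMod.stdAddChar (n : ZMod d) * (B ^ n).trace := by
    have h2 := pow_mul_pow_of_mul_eq_omega_smul h n 1
    rw [pow_one, Nat.cast_one (R := ZMod d), mul_one] at h2
    have hinv' : A * A ^ (d - 1) = 1 := by rw [← pow_succ', pow_succ, hinv]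
    calc (B ^ n).trace = (B ^ n * A * A ^ (d - 1)).trace := by
          rw [Matrix.mul_assoc, hinv', Matrix.mul_one]
      _ = ZMod.stdAddChar (n : ZMod d) * (B ^ n).trace := by
          rw [h2, Matrix.smul_mul, Matrix.trace_smul, Matrix.trace_mul_comm, ← Matrix.mul_assoc,
            hinv, Matrix.one_mul, smul_eq_mul]
  by_contra h0
  have h3 : ZMod.stdAddChar (n : ZMod d) = 1 := by
    apply mul_right_cancel₀ h0
    rw [one_mul, ← h1]
  rw [← AddChar.map_zero_eq_one (ZMod.stdAddChar (N := d))] at h3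
  exact hn (ZMod.injective_stdAddChar h3)

lemma exists_unit_fixed_vector (hA : A ^ d = 1) (hB : B ^ d = 1) (h : B * A = omega d • (A * B)) :
    ∃ v : Fin d → ℂ, star v ⬝ᵥ v = 1 ∧ B *ᵥ v = v := by
  set P : Matrix (Fin d) (Fin d) ℂ := ∑ k ∈ Finset.range d, B ^ k with hP
  have hBP : B * P = P := by
    have h1 := mul_geom_sum B d
    rw [hB, sub_self, sub_mul, one_mul, sub_eq_zero] at h1
    exact h1
  have htr : P.trace = d := by
    rw [hP, Matrix.trace_sum, Finset.sum_eq_single 0]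
    · simp
    · intro k hk hk0
      refine trace_pow_eq_zero hA h fun hz => hk0 ?_
      rw [ZMod.natCast_eq_zero_iff] at hz
      exact Nat.eq_zero_of_dvd_of_lt hz (Finset.mem_range.1 hk)
    · simp [NeZero.ne d]
  obtain ⟨w, hw⟩ : ∃ w, P *ᵥ w ≠ 0 := by
    by_contra! hw
    have hP0 : P = 0 := Matrix.ext_of_mulVec_single fun i => by rw [hw, Matrix.zero_mulVec]
    rw [hP0, Matrix.trace_zero] at htr
    exact NeZero.ne d (by exact_mod_cast htr.symm)
  set u := P *ᵥ w with hu
  have hBu : B *ᵥ u = u := by rw [hu, Matrix.mulVec_mulVec, hBP]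
  have hN : star u ⬝ᵥ u = ((∑ i, ‖u i‖ ^ 2 : ℝ) : ℂ) := by
    simp [dotProduct, Complex.conj_mul']
  have hpos : 0 < ∑ i, ‖u i‖ ^ 2 := by
    obtain ⟨i, hi⟩ := Function.ne_iff.1 hw
    exact Finset.sum_pos' (fun _ _ => by positivity)
      ⟨i, Finset.mem_univ i, by have := norm_pos_iff.2 hi; positivity⟩
  set N : ℝ := ∑ i, ‖u i‖ ^ 2
  refine ⟨((Real.sqrt N)⁻¹ : ℂ) • u, ?_, by rw [Matrix.mulVec_smul, hBu]⟩
  rw [star_smul, smul_dotProduct, dotProduct_smul, hN, smul_smul, smul_eq_mul]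
  have hs : (Real.sqrt N : ℂ) * Real.sqrt N = N := by
    exact_mod_cast Real.mul_self_sqrt hpos.le
  have hN0 : (N : ℂ) ≠ 0 := by exact_mod_cast hpos.ne'
  have hconj : star ((Real.sqrt N : ℂ)⁻¹) = (Real.sqrt N : ℂ)⁻¹ := by
    simp
  rw [hconj, ← mul_inv, hs, inv_mul_cancel₀ hN0]

/-- Uniqueness of the Weyl relations: every unitary pair satisfying the relations of `(S, T)` is
unitarily conjugate to `(S, T)`. -/
lemma exists_unitary_intertwiner (hAU : A ∈ Matrix.unitaryGroup (Fin d) ℂ)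
    (hBU : B ∈ Matrix.unitaryGroup (Fin d) ℂ) (hA : A ^ d = 1) (hB : B ^ d = 1)
    (h : B * A = omega d • (A * B)) :
    ∃ U ∈ Matrix.unitaryGroup (Fin d) ℂ, U * Smat d = A * U ∧ U * Tmat d = B * U := by
  obtain ⟨v, hv1, hBv⟩ := exists_unit_fixed_vector hA hB h
  have hd : 0 < d := Nat.pos_of_ne_zero (NeZero.ne d)
  have heig : ∀ n : ℕ, B *ᵥ (A ^ n *ᵥ v) = omega d ^ n • (A ^ n *ᵥ v) := by
    intro n
    have h1 := pow_mul_pow_of_mul_eq_omega_smul h 1 n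
    rw [pow_one, Nat.cast_one (R := ZMod d), one_mul, ← omega_pow] at h1
    rw [Matrix.mulVec_mulVec, h1, Matrix.smul_mulVec, ← Matrix.mulVec_mulVec, hBv]
  refine ⟨Matrix.of fun i j => (A ^ (j : ℕ) *ᵥ v) i, ?_, ?_, ?_⟩
  · rw [Matrix.mem_unitaryGroup_iff', Matrix.star_eq_conjTranspose]
    ext r s
    change star (A ^ (r : ℕ) *ᵥ v) ⬝ᵥ (A ^ (s : ℕ) *ᵥ v) = _
    by_cases hrs : r = s
    · subst hrs
      rw [star_mulVec_dotProduct_mulVec (pow_mem hAU _), hv1, Matrix.one_apply_eq]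
    · rw [Matrix.one_apply_ne hrs]
      have h2 := star_mulVec_dotProduct_mulVec hBU (A ^ (r : ℕ) *ᵥ v) (A ^ (s : ℕ) *ᵥ v)
      rw [heig, heig, star_smul, smul_dotProduct, dotProduct_smul, smul_smul, smul_eq_mul] at h2
      by_contra h0
      have h3 : star (omega d ^ (r : ℕ)) * omega d ^ (s : ℕ) = 1 :=
        mul_right_cancel₀ h0 (by rw [h2, one_mul])
      have h4 : omega d ^ (r : ℕ) * star (omega d ^ (r : ℕ)) = 1 := by
        rw [RCLike.star_def, Complex.mul_conj', norm_pow, norm_omega]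
        simp
      have h5 : omega d ^ (s : ℕ) = omega d ^ (r : ℕ) := by
        rw [← mul_one (omega d ^ (r : ℕ)), ← h3, ← mul_assoc, h4, one_mul]
      rw [omega_pow, omega_pow] at h5
      have h6 := ZMod.injective_stdAddChar h5
      rw [ZMod.natCast_eq_natCast_iff] at h6
      exact hrs (Fin.ext (Nat.ModEq.eq_of_lt_of_lt h6.symm r.2 s.2))
  · ext i s
    have hR : (A * Matrix.of fun i (j : Fin d) => (A ^ (j : ℕ) *ᵥ v) i) i s
        = (A ^ ((s : ℕ) + 1) *ᵥ v) i := by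
      rw [pow_succ', ← Matrix.mulVec_mulVec]
      rfl
    rw [hR, Matrix.mul_apply, Finset.sum_eq_single ⟨((s : ℕ) + 1) % d, Nat.mod_lt _ hd⟩]
    · simp [Smat, ← pow_eq_pow_mod _ hA]
    · intro b _ hb
      have : (b : ℕ) ≠ ((s : ℕ) + 1) % d := fun h => hb (Fin.ext h)
      simp [Smat, this]
    · simp
  · ext i s
    have hR : (B * Matrix.of fun i (j : Fin d) => (A ^ (j : ℕ) *ᵥ v) i) i s
        = (B *ᵥ (A ^ (s : ℕ) *ᵥ v)) i := rfl
    rw [hR, heig, Tmat, Matrix.mul_diagonal]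
    simp [mul_comm]

end IntertwiningPair

lemma weyl_natCast (m n : ℕ) :
    weyl ((m : ZMod d), (n : ZMod d)) = Smat d ^ m * Tmat d ^ n := by
  simp only [weyl, ZMod.val_natCast]
  rw [← pow_eq_pow_mod _ Smat_pow_self, ← pow_eq_pow_mod _ Tmat_pow_self]

lemma weyl_mul_weyl (p q : ZMod d × ZMod d) :
    weyl p * weyl q = ZMod.stdAddChar (p.2 * q.1) • weyl (p + q) := by
  have h := pow_mul_pow_of_mul_eq_omega_smul (Tmat_mul_Smat (d := d)) p.2.val q.1.val
  rw [ZMod.natCast_zmod_val, ZMod.natCast_zmod_val] at h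
  have hpq : p + q = (((p.1.val + q.1.val : ℕ) : ZMod d), ((p.2.val + q.2.val : ℕ) : ZMod d)) := by
    ext <;> simp
  rw [hpq, weyl_natCast, pow_add, pow_add]
  calc weyl p * weyl q
      = Smat d ^ p.1.val * (Tmat d ^ p.2.val * Smat d ^ q.1.val) * Tmat d ^ q.2.val := by
        simp only [weyl, Matrix.mul_assoc]
    _ = _ := by
        rw [h, Matrix.mul_smul, Matrix.smul_mul]
        simp only [Matrix.mul_assoc]

lemma weyl_mul_weyl_comm (p q : ZMod d × ZMod d) :
    weyl q * weyl p = ZMod.stdAddChar (p.1 * q.2 - p.2 * q.1) • (weyl p * weyl q) := by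
  rw [weyl_mul_weyl, weyl_mul_weyl, smul_smul, ← AddChar.map_add_eq_mul, add_comm q p]
  congr 2
  ring

lemma weyl_mem_unitaryGroup (p : ZMod d × ZMod d) : weyl p ∈ Matrix.unitaryGroup (Fin d) ℂ :=
  mul_mem (pow_mem Smat_mem_unitaryGroup _) (pow_mem Tmat_mem_unitaryGroup _)

lemma mul_weyl_ne_zero {M : Matrix (Fin d) (Fin d) ℂ} (hM : M ≠ 0) (p : ZMod d × ZMod d) :
    M * weyl p ≠ 0 := by
  intro h
  apply hM
  rw [← Matrix.mul_one M, ← Matrix.mem_unitaryGroup_iff.1 (weyl_mem_unitaryGroup p),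
    ← Matrix.mul_assoc, h, Matrix.zero_mul]

lemma weyl_ne_zero (p : ZMod d × ZMod d) : weyl p ≠ 0 := by
  simpa using mul_weyl_ne_zero (one_ne_zero (α := Matrix (Fin d) (Fin d) ℂ)) p

lemma smul_weyl_inj {c c' : ℂ} (hc : c ≠ 0) {p q : ZMod d × ZMod d}
    (h : c • weyl p = c' • weyl q) : c = c' ∧ p = q := by
  have hM : c • weyl p ≠ 0 := smul_ne_zero hc (weyl_ne_zero p)
  have key : ∀ r : ZMod d × ZMod d, p.1 * r.2 - p.2 * r.1 = q.1 * r.2 - q.2 * r.1 := by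
    intro r
    have h1 : weyl r * (c • weyl p) =
        ZMod.stdAddChar (p.1 * r.2 - p.2 * r.1) • (c • weyl p * weyl r) := by
      rw [Matrix.mul_smul, weyl_mul_weyl_comm p r, Matrix.smul_mul, smul_comm]
    have h2 : weyl r * (c • weyl p) =
        ZMod.stdAddChar (q.1 * r.2 - q.2 * r.1) • (c • weyl p * weyl r) := by
      rw [h, Matrix.mul_smul, weyl_mul_weyl_comm q r, Matrix.smul_mul, smul_comm]
    exact ZMod.injective_stdAddChar
      (smul_left_injective ℂ (mul_weyl_ne_zero hM r) (h1.symm.trans h2))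
  have hpq : p = q := by
    ext
    · simpa using key (0, 1)
    · simpa using key (1, 0)
  subst hpq
  exact ⟨smul_left_injective ℂ (weyl_ne_zero p) h, rfl⟩

lemma IsPhaseWeyl.mul {p q : ZMod d × ZMod d} {M N : Matrix (Fin d) (Fin d) ℂ}
    (hM : IsPhaseWeyl p M) (hN : IsPhaseWeyl q N) : IsPhaseWeyl (p + q) (M * N) := by
  obtain ⟨c, hc, rfl⟩ := hM
  obtain ⟨c', hc', rfl⟩ := hN
  refine ⟨c * c' * ZMod.stdAddChar (p.2 * q.1), ?_, ?_⟩
  · rw [norm_mul, norm_mul, hc, hc', ZMod.stdAddChar_apply, Circle.norm_coe]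
    norm_num
  · rw [smul_mul_smul_comm, weyl_mul_weyl, smul_smul]

lemma IsPhaseWeyl.pow {p : ZMod d × ZMod d} {M : Matrix (Fin d) (Fin d) ℂ}
    (hM : IsPhaseWeyl p M) (n : ℕ) : IsPhaseWeyl (n • p) (M ^ n) := by
  induction n with
  | zero => exact ⟨1, norm_one, by simp [weyl_zero]⟩
  | succ n ih =>
    rw [succ_nsmul, pow_succ]
    exact ih.mul hM

lemma IsPhaseWeyl.mem_unitaryGroup {p : ZMod d × ZMod d} {M : Matrix (Fin d) (Fin d) ℂ}
    (hM : IsPhaseWeyl p M) : M ∈ Matrix.unitaryGroup (Fin d) ℂ := by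
  obtain ⟨c, hc, rfl⟩ := hM
  rw [Matrix.mem_unitaryGroup_iff', star_smul, smul_mul_smul_comm,
    Matrix.mem_unitaryGroup_iff'.1 (weyl_mem_unitaryGroup p), RCLike.star_def, Complex.conj_mul', hc]
  simp

lemma zpow_eq_pow_val {M : Matrix (Fin d) (Fin d) ℂ} (hM : M ^ d = 1) (z : ℤ) :
    M ^ z = M ^ (z : ZMod d).val := by
  have hdet : IsUnit M.det := by
    have h : IsUnit (M ^ d).det := by rw [hM]; simp
    rw [Matrix.det_pow] at h
    exact (isUnit_pow_iff (NeZero.ne d)).1 h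
  have hz : M ^ (z % d) = M ^ z := by
    conv_rhs => rw [← Int.emod_add_mul_ediv z d, Matrix.zpow_add hdet, Matrix.zpow_mul _ hdet,
      zpow_natCast, hM, Matrix.one_zpow, Matrix.mul_one]
  rw [← hz, ← zpow_natCast, ZMod.val_intCast]

lemma mem_Wset_iff {M : Matrix (Fin d) (Fin d) ℂ} : M ∈ Wset d ↔ ∃ p, IsPhaseWeyl p M := by
  have hD : ∀ p : ℤ × ℤ,
      Dmat d p = tau d ^ (p.1 * p.2) • weyl ((p.1 : ZMod d), (p.2 : ZMod d)) := by
    intro p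
    rw [Dmat, weyl, zpow_eq_pow_val Smat_pow_self, zpow_eq_pow_val Tmat_pow_self]
  have hτ : ∀ n : ℤ, ‖tau d ^ n‖ = 1 := by
    intro n
    rw [norm_zpow, norm_tau, _root_.one_zpow]
  constructor
  · rintro ⟨ξ, p, rfl⟩
    rw [hD]
    exact ⟨_, ((isPhaseWeyl_weyl _).smul (hτ _)).smul (Complex.norm_exp_ofReal_mul_I ξ)⟩
  · rintro ⟨p, c, hc, rfl⟩
    set P : ℤ × ℤ := ((p.1.val : ℤ), (p.2.val : ℤ)) with hP
    have hPp : (((P.1 : ℤ) : ZMod d), ((P.2 : ℤ) : ZMod d)) = p := by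
      ext <;> simp [hP]
    set t := tau d ^ (P.1 * P.2) with ht
    have ht1 : ‖c * t⁻¹‖ = 1 := by rw [norm_mul, norm_inv, hc, hτ]; norm_num
    obtain ⟨ξ, hξ⟩ := (Complex.norm_eq_one_iff _).1 ht1
    refine ⟨ξ, P, ?_⟩
    have ht0 : t ≠ 0 := norm_ne_zero_iff.1 (by rw [hτ]; exact one_ne_zero)
    rw [hD, hPp, hξ, smul_smul, inv_mul_cancel_right₀ ht0]

lemma exists_phase_smul_weyl_pow_eq_one (p : ZMod d × ZMod d) :
    ∃ c : ℂ, ‖c‖ = 1 ∧ (c • weyl p) ^ d = 1 := by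
  have hd : 0 < d := Nat.pos_of_ne_zero (NeZero.ne d)
  obtain ⟨k, hk, hE⟩ := (isPhaseWeyl_weyl p).pow d
  have hdp : d • p = 0 := by ext <;> simp
  rw [hdp, weyl_zero] at hE
  obtain ⟨c, hc⟩ := IsAlgClosed.exists_pow_nat_eq k⁻¹ hd
  have hk0 : k ≠ 0 := norm_ne_zero_iff.1 (by rw [hk]; exact one_ne_zero)
  refine ⟨c, ?_, ?_⟩
  · rw [← pow_eq_one_iff_of_nonneg (norm_nonneg c) hd.ne', ← norm_pow, hc, norm_inv, hk, inv_one]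
  · rw [smul_pow, hc, hE, smul_smul, inv_mul_cancel₀ hk0, one_smul]

/-- A phase making the `d`-th power of the Weyl operator at `p` trivial. -/
def weylPhase (p : ZMod d × ZMod d) : ℂ := (exists_phase_smul_weyl_pow_eq_one p).choose

lemma norm_weylPhase (p : ZMod d × ZMod d) : ‖weylPhase p‖ = 1 :=
  (exists_phase_smul_weyl_pow_eq_one p).choose_spec.1

lemma weylPhase_smul_weyl_pow (p : ZMod d × ZMod d) : (weylPhase p • weyl p) ^ d = 1 :=
  (exists_phase_smul_weyl_pow_eq_one p).choose_spec.2

lemma weylPhase_ne_zero (p : ZMod d × ZMod d) : weylPhase p ≠ 0 :=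
  norm_ne_zero_iff.1 (by rw [norm_weylPhase]; exact one_ne_zero)

lemma stdAddChar_pow_self (k : ZMod d) : ZMod.stdAddChar k ^ d = 1 := by
  rw [← AddChar.map_nsmul_eq_pow, nsmul_eq_mul, CharP.cast_eq_zero, zero_mul,
    AddChar.map_zero_eq_one]

lemma norm_stdAddChar (k : ZMod d) : ‖ZMod.stdAddChar k‖ = 1 := by
  rw [ZMod.stdAddChar_apply, Circle.norm_coe]

lemma exists_stdAddChar_eq_of_pow_eq_one {z : ℂ} (hz : z ^ d = 1) :
    ∃ k : ZMod d, z = ZMod.stdAddChar k := by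
  obtain ⟨i, -, hi⟩ := (Complex.isPrimitiveRoot_exp d (NeZero.ne d)).eq_pow_of_pow_eq_one hz
  exact ⟨i, by rw [← omega_pow, ← hi]; rfl⟩

/-- The element of `W(d)` over `p` with trivial `d`-th power, indexed by `k ∈ ℤ/dℤ`. -/
def weylRoot (k : ZMod d) (p : ZMod d × ZMod d) : Matrix (Fin d) (Fin d) ℂ :=
  (ZMod.stdAddChar k * weylPhase p) • weyl p

lemma isPhaseWeyl_weylRoot (k : ZMod d) (p : ZMod d × ZMod d) :
    IsPhaseWeyl p (weylRoot k p) :=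
  ⟨_, by rw [norm_mul, norm_stdAddChar, norm_weylPhase, one_mul], rfl⟩

lemma weylRoot_pow_self (k : ZMod d) (p : ZMod d × ZMod d) : weylRoot k p ^ d = 1 := by
  rw [weylRoot, mul_smul, smul_pow, stdAddChar_pow_self, weylPhase_smul_weyl_pow, one_smul]

lemma weylRoot_inj {k l : ZMod d} {p q : ZMod d × ZMod d} (h : weylRoot k p = weylRoot l q) :
    k = l ∧ p = q := by
  have h0 : ZMod.stdAddChar k * weylPhase p ≠ 0 :=
    norm_ne_zero_iff.1 (by rw [norm_mul, norm_stdAddChar, norm_weylPhase]; norm_num)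
  obtain ⟨h1, rfl⟩ := smul_weyl_inj h0 h
  exact ⟨ZMod.injective_stdAddChar (mul_right_cancel₀ (weylPhase_ne_zero p) h1), rfl⟩

lemma exists_eq_weylRoot {M : Matrix (Fin d) (Fin d) ℂ} (hM : M ∈ Wset d) (hMd : M ^ d = 1) :
    ∃ k p, M = weylRoot k p := by
  obtain ⟨p, c, -, rfl⟩ := mem_Wset_iff.1 hM
  have hc : c = c / weylPhase p * weylPhase p := (div_mul_cancel₀ c (weylPhase_ne_zero p)).symm
  have h1 : (c / weylPhase p) ^ d = 1 := by
    rw [hc, mul_smul, smul_pow, weylPhase_smul_weyl_pow] at hMd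
    simpa using congrFun (congrFun hMd 0) 0
  obtain ⟨k, hk⟩ := exists_stdAddChar_eq_of_pow_eq_one h1
  exact ⟨k, p, by rw [weylRoot, ← hk, ← hc]⟩

lemma weylRoot_mul_weylRoot_eq_omega_smul_iff {k l : ZMod d} {p q : ZMod d × ZMod d} :
    weylRoot l q * weylRoot k p = omega d • (weylRoot k p * weylRoot l q) ↔
      p.1 * q.2 - p.2 * q.1 = 1 := by
  have h : weylRoot l q * weylRoot k p =
      ZMod.stdAddChar (p.1 * q.2 - p.2 * q.1) • (weylRoot k p * weylRoot l q) := by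
    rw [weylRoot, weylRoot, smul_mul_smul_comm, smul_mul_smul_comm, weyl_mul_weyl_comm p q,
      smul_comm, mul_comm (_ * weylPhase q)]
  have hne : weylRoot k p * weylRoot l q ≠ 0 := by
    obtain ⟨c, hc, hE⟩ := (isPhaseWeyl_weylRoot k p).mul (isPhaseWeyl_weylRoot l q)
    rw [hE]
    exact smul_ne_zero (norm_ne_zero_iff.1 (by rw [hc]; exact one_ne_zero)) (weyl_ne_zero _)
  rw [h, omega_eq_stdAddChar, (smul_left_injective ℂ hne).eq_iff,
    ZMod.injective_stdAddChar.eq_iff]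

variable (d) in
/-- The pairs in `W(d)` satisfying the relations of `(S, T)`. -/
def weylPairs : Set (Matrix (Fin d) (Fin d) ℂ × Matrix (Fin d) (Fin d) ℂ) :=
  {x | x.1 ∈ Wset d ∧ x.2 ∈ Wset d ∧ x.1 ^ d = 1 ∧ x.2 ^ d = 1 ∧
    x.2 * x.1 = omega d • (x.1 * x.2)}

lemma card_weylPairs :
    Nat.card (weylPairs d) =
      d ^ 2 * Nat.card {x : (ZMod d × ZMod d) × (ZMod d × ZMod d) //
        x.1.1 * x.2.2 - x.1.2 * x.2.1 = 1} := by
  let f : (ZMod d × ZMod d) × {x : (ZMod d × ZMod d) × (ZMod d × ZMod d) //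
      x.1.1 * x.2.2 - x.1.2 * x.2.1 = 1} → weylPairs d := fun y =>
    ⟨(weylRoot y.1.1 y.2.1.1, weylRoot y.1.2 y.2.1.2),
      mem_Wset_iff.2 ⟨_, isPhaseWeyl_weylRoot _ _⟩, mem_Wset_iff.2 ⟨_, isPhaseWeyl_weylRoot _ _⟩,
      weylRoot_pow_self _ _, weylRoot_pow_self _ _,
      weylRoot_mul_weylRoot_eq_omega_smul_iff.2 y.2.2⟩
  have hf : Function.Bijective f := by
    constructor
    · rintro ⟨⟨k, l⟩, ⟨⟨p, q⟩, h⟩⟩ ⟨⟨k', l'⟩, ⟨⟨p', q'⟩, h'⟩⟩ hyz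
      have h1 := congrArg Subtype.val hyz
      obtain ⟨rfl, rfl⟩ := weylRoot_inj (congrArg Prod.fst h1)
      obtain ⟨rfl, rfl⟩ := weylRoot_inj (congrArg Prod.snd h1)
      rfl
    · rintro ⟨⟨A, B⟩, hA, hB, hAd, hBd, hAB⟩
      obtain ⟨k, p, rfl⟩ := exists_eq_weylRoot hA hAd
      obtain ⟨l, q, rfl⟩ := exists_eq_weylRoot hB hBd
      exact ⟨((k, l), ⟨(p, q), weylRoot_mul_weylRoot_eq_omega_smul_iff.1 hAB⟩), rfl⟩
  rw [← Nat.card_eq_of_bijective f hf, Nat.card_prod, Nat.card_prod, Nat.card_zmod, sq]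

lemma card_det_eq_one :
    Nat.card {x : (ZMod d × ZMod d) × (ZMod d × ZMod d) // x.1.1 * x.2.2 - x.1.2 * x.2.1 = 1} =
      ∑ n ∈ Finset.range d, nu d n * nu d (n + 1) := by
  let e : {x : (ZMod d × ZMod d) × (ZMod d × ZMod d) // x.1.1 * x.2.2 - x.1.2 * x.2.1 = 1} ≃
      Σ m : ZMod d, {y : ZMod d × ZMod d // y.1 * y.2 = m} ×
        {y : ZMod d × ZMod d // y.1 * y.2 = m + 1} :=
    { toFun := fun x => ⟨x.1.1.2 * x.1.2.1, ⟨(x.1.1.2, x.1.2.1), rfl⟩,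
        ⟨(x.1.1.1, x.1.2.2), by linear_combination x.2⟩⟩
      invFun := fun z => ⟨((z.2.2.1.1, z.2.1.1.1), (z.2.1.1.2, z.2.2.1.2)), by
        linear_combination z.2.2.2 - z.2.1.2⟩
      left_inv := fun _ => rfl
      right_inv := by
        rintro ⟨_, ⟨⟨b, c⟩, rfl⟩, y⟩
        rfl }
  rw [Nat.card_congr e, Nat.card_sigma]
  refine Finset.sum_bij' (fun m _ => m.val) (fun n _ => (n : ZMod d)) ?_ ?_ ?_ ?_ ?_
  · exact fun m _ => Finset.mem_range.2 m.val_lt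
  · exact fun _ _ => Finset.mem_univ _
  · exact fun m _ => ZMod.natCast_zmod_val m
  · exact fun n hn => ZMod.val_cast_of_lt (Finset.mem_range.1 hn)
  · intro m _
    rw [Nat.card_prod, nu, nu, Nat.cast_succ, ZMod.natCast_zmod_val]

lemma mem_Cliff_of_intertwines {p q : ZMod d × ZMod d} {A B : Matrix (Fin d) (Fin d) ℂ}
    (hA : IsPhaseWeyl p A) (hB : IsPhaseWeyl q B) (hpq : p.1 * q.2 - p.2 * q.1 = 1)
    (U : Matrix.unitaryGroup (Fin d) ℂ) (hS : (U : Matrix (Fin d) (Fin d) ℂ) * Smat d = A * U)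
    (hT : (U : Matrix (Fin d) (Fin d) ℂ) * Tmat d = B * U) : U ∈ Cliff d := by
  have hconj : ∀ r : ZMod d × ZMod d, IsPhaseWeyl (r.1.val • p + r.2.val • q)
      ((U : Matrix (Fin d) (Fin d) ℂ) * weyl r * (U : Matrix (Fin d) (Fin d) ℂ)ᴴ) := by
    intro r
    have h : SemiconjBy (U : Matrix (Fin d) (Fin d) ℂ) (weyl r) (A ^ r.1.val * B ^ r.2.val) :=
      SemiconjBy.mul_right (SemiconjBy.pow_right hS _) (SemiconjBy.pow_right hT _)
    rw [h.eq, Matrix.mul_assoc, ← Matrix.star_eq_conjTranspose,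
      Matrix.mem_unitaryGroup_iff.1 U.2, Matrix.mul_one]
    exact (hA.pow _).mul (hB.pow _)
  change _ '' Wset d = Wset d
  apply Set.Subset.antisymm
  · rintro _ ⟨M, hM, rfl⟩
    obtain ⟨r, c, hc, rfl⟩ := mem_Wset_iff.1 hM
    simp only [Matrix.mul_smul, Matrix.smul_mul]
    exact mem_Wset_iff.2 ⟨_, (hconj r).smul hc⟩
  · intro M hM
    obtain ⟨s, c, hc, rfl⟩ := mem_Wset_iff.1 hM
    set r : ZMod d × ZMod d := (s.1 * q.2 - s.2 * q.1, s.2 * p.1 - s.1 * p.2) with hr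
    have hrs : r.1.val • p + r.2.val • q = s := by
      ext
      · rw [Prod.fst_add, Prod.smul_fst, Prod.smul_fst]
        simp only [nsmul_eq_mul, ZMod.natCast_zmod_val, hr]
        linear_combination s.1 * hpq
      · rw [Prod.snd_add, Prod.smul_snd, Prod.smul_snd]
        simp only [nsmul_eq_mul, ZMod.natCast_zmod_val, hr]
        linear_combination s.2 * hpq
    obtain ⟨c', hc', hE⟩ := hconj r
    rw [hrs] at hE
    have hc0 : c' ≠ 0 := norm_ne_zero_iff.1 (by rw [hc']; exact one_ne_zero)
    refine ⟨(c / c') • weyl r,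
      mem_Wset_iff.2 ⟨r, c / c', by rw [norm_div, hc, hc', div_one], rfl⟩, ?_⟩
    simp only [Matrix.mul_smul, Matrix.smul_mul]
    rw [hE, smul_smul, div_mul_cancel₀ _ hc0]

lemma conj_mem_weylPairs (U : Cliff d) :
    ((U.1 : Matrix (Fin d) (Fin d) ℂ) * Smat d * (U.1 : Matrix (Fin d) (Fin d) ℂ)ᴴ,
      (U.1 : Matrix (Fin d) (Fin d) ℂ) * Tmat d * (U.1 : Matrix (Fin d) (Fin d) ℂ)ᴴ) ∈
      weylPairs d := by
  have hU : (U.1 : Matrix (Fin d) (Fin d) ℂ)ᴴ * (U.1 : Matrix (Fin d) (Fin d) ℂ) = 1 :=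
    Matrix.mem_unitaryGroup_iff'.1 U.1.2
  have hU' : (U.1 : Matrix (Fin d) (Fin d) ℂ) * (U.1 : Matrix (Fin d) (Fin d) ℂ)ᴴ = 1 :=
    Matrix.mem_unitaryGroup_iff.1 U.1.2
  have hmem : ∀ M ∈ Wset d,
      (U.1 : Matrix (Fin d) (Fin d) ℂ) * M * (U.1 : Matrix (Fin d) (Fin d) ℂ)ᴴ ∈ Wset d := by
    intro M hM
    have h : _ '' Wset d = Wset d := U.2
    rw [← h]
    exact ⟨M, hM, rfl⟩
  have hmul : ∀ M N : Matrix (Fin d) (Fin d) ℂ,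
      (U.1 : Matrix (Fin d) (Fin d) ℂ) * M * (U.1 : Matrix (Fin d) (Fin d) ℂ)ᴴ *
        ((U.1 : Matrix (Fin d) (Fin d) ℂ) * N * (U.1 : Matrix (Fin d) (Fin d) ℂ)ᴴ) =
      (U.1 : Matrix (Fin d) (Fin d) ℂ) * (M * N) * (U.1 : Matrix (Fin d) (Fin d) ℂ)ᴴ := by
    intro M N
    calc _ = (U.1 : Matrix (Fin d) (Fin d) ℂ) * M * ((U.1 : Matrix (Fin d) (Fin d) ℂ)ᴴ * U.1) * N *
          (U.1 : Matrix (Fin d) (Fin d) ℂ)ᴴ := by simp only [Matrix.mul_assoc]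
      _ = _ := by rw [hU, Matrix.mul_one]; simp only [Matrix.mul_assoc]
  have hpow : ∀ (M : Matrix (Fin d) (Fin d) ℂ), M ^ d = 1 →
      ((U.1 : Matrix (Fin d) (Fin d) ℂ) * M * (U.1 : Matrix (Fin d) (Fin d) ℂ)ᴴ) ^ d = 1 := by
    intro M hM
    have h : ∀ n, ((U.1 : Matrix (Fin d) (Fin d) ℂ) * M * (U.1 : Matrix (Fin d) (Fin d) ℂ)ᴴ) ^ n =
        (U.1 : Matrix (Fin d) (Fin d) ℂ) * M ^ n * (U.1 : Matrix (Fin d) (Fin d) ℂ)ᴴ := by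
      intro n
      induction n with
      | zero => simp [hU']
      | succ n ih => rw [pow_succ, ih, hmul, pow_succ]
    rw [h, hM, Matrix.mul_one, hU']
  have hS : Smat d ∈ Wset d := mem_Wset_iff.2 ⟨_, 1, norm_one, by
    rw [one_smul]; simpa using (weyl_natCast (d := d) 1 0).symm⟩
  have hT : Tmat d ∈ Wset d := mem_Wset_iff.2 ⟨_, 1, norm_one, by
    rw [one_smul]; simpa using (weyl_natCast (d := d) 0 1).symm⟩
  refine ⟨hmem _ hS, hmem _ hT, hpow _ Smat_pow_self, hpow _ Tmat_pow_self, ?_⟩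
  simp only
  rw [hmul, hmul, Tmat_mul_Smat, Matrix.mul_smul, Matrix.smul_mul]

lemma inv_mul_mem_CcSub_iff (U V : Cliff d) :
    U⁻¹ * V ∈ CcSub d ↔
      ((U.1 : Matrix (Fin d) (Fin d) ℂ) * Smat d * (U.1 : Matrix (Fin d) (Fin d) ℂ)ᴴ =
        (V.1 : Matrix (Fin d) (Fin d) ℂ) * Smat d * (V.1 : Matrix (Fin d) (Fin d) ℂ)ᴴ ∧
      (U.1 : Matrix (Fin d) (Fin d) ℂ) * Tmat d * (U.1 : Matrix (Fin d) (Fin d) ℂ)ᴴ =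
        (V.1 : Matrix (Fin d) (Fin d) ℂ) * Tmat d * (V.1 : Matrix (Fin d) (Fin d) ℂ)ᴴ) := by
  have hU : (U.1 : Matrix (Fin d) (Fin d) ℂ)ᴴ * (U.1 : Matrix (Fin d) (Fin d) ℂ) = 1 :=
    Matrix.mem_unitaryGroup_iff'.1 U.1.2
  have hU' : (U.1 : Matrix (Fin d) (Fin d) ℂ) * (U.1 : Matrix (Fin d) (Fin d) ℂ)ᴴ = 1 :=
    Matrix.mem_unitaryGroup_iff.1 U.1.2
  have hV : (V.1 : Matrix (Fin d) (Fin d) ℂ)ᴴ * (V.1 : Matrix (Fin d) (Fin d) ℂ) = 1 :=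
    Matrix.mem_unitaryGroup_iff'.1 V.1.2
  have hV' : (V.1 : Matrix (Fin d) (Fin d) ℂ) * (V.1 : Matrix (Fin d) (Fin d) ℂ)ᴴ = 1 :=
    Matrix.mem_unitaryGroup_iff.1 V.1.2
  have key : ∀ M : Matrix (Fin d) (Fin d) ℂ,
      (U.1 : Matrix (Fin d) (Fin d) ℂ) * M * (U.1 : Matrix (Fin d) (Fin d) ℂ)ᴴ =
        (V.1 : Matrix (Fin d) (Fin d) ℂ) * M * (V.1 : Matrix (Fin d) (Fin d) ℂ)ᴴ ↔
      (U.1 : Matrix (Fin d) (Fin d) ℂ)ᴴ * V.1 * M = M * ((U.1 : Matrix (Fin d) (Fin d) ℂ)ᴴ * V.1) := by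
    intro M
    generalize (U.1 : Matrix (Fin d) (Fin d) ℂ) = u at *
    generalize (V.1 : Matrix (Fin d) (Fin d) ℂ) = v at *
    constructor
    · intro h
      calc uᴴ * v * M = uᴴ * (v * M * vᴴ) * v := by
            simp only [Matrix.mul_assoc, hV, Matrix.mul_one]
        _ = (uᴴ * u) * M * (uᴴ * v) := by rw [← h]; simp only [Matrix.mul_assoc]
        _ = _ := by rw [hU, Matrix.one_mul]
    · intro h
      calc u * M * uᴴ = u * (M * (uᴴ * v)) * vᴴ := by
            simp only [Matrix.mul_assoc, hV', Matrix.mul_one]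
        _ = (u * uᴴ) * v * M * vᴴ := by rw [← h]; simp only [Matrix.mul_assoc]
        _ = _ := by rw [hU', Matrix.one_mul]
  rw [key, key]
  change (∃ c : ℂ, (U.1 : Matrix (Fin d) (Fin d) ℂ)ᴴ * (V.1 : Matrix (Fin d) (Fin d) ℂ) = c • 1) ↔ _
  constructor
  · rintro ⟨c, hc⟩
    rw [hc]
    simp
  · rintro ⟨hS, hT⟩
    exact eq_smul_one_of_commute hS hT

lemma card_Cliff_quotient : Nat.card (Cliff d ⧸ CcSub d) = Nat.card (weylPairs d) := by
  let f : Cliff d → weylPairs d := fun U => ⟨_, conj_mem_weylPairs U⟩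
  have hf : ∀ U V, U⁻¹ * V ∈ CcSub d ↔ f U = f V := by
    intro U V
    rw [inv_mul_mem_CcSub_iff, Subtype.ext_iff, Prod.ext_iff]
  let g : Cliff d ⧸ CcSub d → weylPairs d :=
    Quotient.lift f fun U V h => (hf U V).1 (QuotientGroup.leftRel_apply.1 h)
  refine Nat.card_eq_of_bijective g ⟨?_, ?_⟩
  · intro x y
    induction x using QuotientGroup.induction_on with | H U
    induction y using QuotientGroup.induction_on with | H V
    exact fun h => QuotientGroup.eq.2 ((hf U V).2 h)
  · rintro ⟨⟨A, B⟩, hA, hB, hAd, hBd, hAB⟩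
    obtain ⟨k, p, rfl⟩ := exists_eq_weylRoot hA hAd
    obtain ⟨l, q, rfl⟩ := exists_eq_weylRoot hB hBd
    obtain ⟨U, hU, hS, hT⟩ := exists_unitary_intertwiner
      (isPhaseWeyl_weylRoot k p).mem_unitaryGroup (isPhaseWeyl_weylRoot l q).mem_unitaryGroup
      hAd hBd hAB
    have hC := mem_Cliff_of_intertwines (isPhaseWeyl_weylRoot k p) (isPhaseWeyl_weylRoot l q)
      (weylRoot_mul_weylRoot_eq_omega_smul_iff.1 hAB) ⟨U, hU⟩ hS hT
    have hUU : U * Uᴴ = 1 := Matrix.mem_unitaryGroup_iff.1 hU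
    refine ⟨QuotientGroup.mk ⟨⟨U, hU⟩, hC⟩, Subtype.ext (Prod.ext ?_ ?_)⟩
    · change U * Smat d * Uᴴ = _
      rw [hS, Matrix.mul_assoc, hUU, Matrix.mul_one]
    · change U * Tmat d * Uᴴ = _
      rw [hT, Matrix.mul_assoc, hUU, Matrix.mul_one]

end

/-- `|C(d)/Cc(d)| = d² · Σ_{n=0}^{d−1} ν(n,d)ν(n+1,d)`. -/
theorem stmt7 (d : ℕ) (hd : 2 ≤ d) :
    Nat.card (Cliff d ⧸ CcSub d) =
      d ^ 2 * ∑ n ∈ Finset.range d, nu d n * nu d (n + 1) := by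
  have : NeZero d := ⟨by lia⟩
  rw [card_Cliff_quotient, card_weylPairs, card_det_eq_one]
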